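/- Let G=(V,w,m) be a locally finite, connected, complete weighted graph with non-degenerate vertex measure, satisfying the curvature dimension condition CD(K,n) for some K>0 and n<∞, and with Deg_max < ∞. Then the combinatorial diameter satisfies diam_d(G) ≤ √(2n·Deg_max/K) · arcsin( 1/√(Kn/(2·Deg_max) + 1) ). -/

import Mathlib

open Filter
open scoped ENNReal

variable {V : Type*}

/-- The degree `deg(x) = ∑_y w(x,y)` of a vertex in a locally finite weighted graph. -/
noncomputable def vertexDeg (w : V → V → ℝ) (x : V) : ℝ := ∑' y, w x y

/-- The normalized degree `Deg(x) = deg(x)/m(x)`. -/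
noncomputable def nDeg (w : V → V → ℝ) (m : V → ℝ) (x : V) : ℝ := vertexDeg w x / m x

/-- The graph Laplacian `Δf(x) = (1/m(x)) ∑_y w(x,y)(f(y) - f(x))`. -/
noncomputable def graphLap (w : V → V → ℝ) (m : V → ℝ) (f : V → ℝ) (x : V) : ℝ :=
  (1 / m x) * ∑' y, w x y * (f y - f x)

/-- The Bakry–Émery operator `Γ`, defined by `2Γ(f,g) = Δ(fg) - fΔg - gΔf`. -/
noncomputable def bakryGamma (w : V → V → ℝ) (m : V → ℝ) (f g : V → ℝ) (x : V) : ℝ :=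
  (graphLap w m (fun z => f z * g z) x - f x * graphLap w m g x - g x * graphLap w m f x) / 2

/-- The carré du champ `Γf(x) = (1/(2m(x))) ∑_y w(x,y)(f(y) - f(x))²`, valued in `[0,∞]`
so that it is meaningful (possibly infinite) for every function `f`. -/
noncomputable def carre (w : V → V → ℝ) (m : V → ℝ) (f : V → ℝ) (x : V) : ℝ≥0∞ :=
  (∑' y, ENNReal.ofReal (w x y * (f y - f x) ^ 2)) / ENNReal.ofReal (2 * m x)

/-- `p` is a walk of length `k` from `x` to `y` along edges of positive weight. -/
def IsWalk (w : V → V → ℝ) (x y : V) (k : ℕ) (p : ℕ → V) : Prop :=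
  p 0 = x ∧ p k = y ∧ ∀ i < k, 0 < w (p i) (p (i + 1))

/-- Connectedness of a weighted graph: any two vertices are joined by a finite path of
consecutive neighbors. -/
def GraphConnected (w : V → V → ℝ) : Prop := ∀ x y : V, ∃ k p, IsWalk w x y k p

/-- The combinatorial distance: the minimal length of a path of consecutive neighbors. -/
noncomputable def combDist (w : V → V → ℝ) (x y : V) : ℕ :=
  sInf {k : ℕ | ∃ p, IsWalk w x y k p}

/-- The resistance distance `ρ(x,y) = sup {|f(y) - f(x)| : ‖Γf‖_∞ ≤ 1}`. -/
noncomputable def resistDist (w : V → V → ℝ) (m : V → ℝ) (x y : V) : ℝ :=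
  sSup {r : ℝ | ∃ f : V → ℝ, (∀ z, carre w m f z ≤ 1) ∧ r = |f y - f x|}

/-- The maximal normalized degree `Deg_max = sup_x deg(x)/m(x)`. -/
noncomputable def nDegMax (w : V → V → ℝ) (m : V → ℝ) : ℝ :=
  sSup (Set.range fun x : V => nDeg w m x)

/-- The iterated Bakry–Émery operator `Γ₂`, defined by
`2Γ₂(f,g) = ΔΓ(f,g) - Γ(f,Δg) - Γ(g,Δf)`. -/
noncomputable def bakryGamma2 (w : V → V → ℝ) (m : V → ℝ) (f g : V → ℝ) (x : V) : ℝ :=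
  (graphLap w m (bakryGamma w m f g) x - bakryGamma w m f (graphLap w m g) x
    - bakryGamma w m g (graphLap w m f) x) / 2

/-- The curvature dimension condition `CD(K,n)`: `Γ₂(f) ≥ (1/n)(Δf)² + KΓf` pointwise. -/
def CDCond (w : V → V → ℝ) (m : V → ℝ) (K n : ℝ) : Prop :=
  ∀ f : V → ℝ, ∀ x : V,
    (1 / n) * (graphLap w m f x) ^ 2 + K * bakryGamma w m f f x ≤ bakryGamma2 w m f f x

/-- Completeness of a weighted graph: there is a nondecreasing sequence of finitely supported
`[0,1]`-valued functions `η_k` converging pointwise to `1` with `Γ η_k ≤ 1/(k+1)` pointwise. -/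
def GraphComplete (w : V → V → ℝ) (m : V → ℝ) : Prop :=
  ∃ η : ℕ → V → ℝ,
    (∀ k x, η k x ∈ Set.Icc (0 : ℝ) 1) ∧
    (∀ k, (Function.support (η k)).Finite) ∧
    (∀ x, Monotone fun k => η k x) ∧
    (∀ x, Filter.Tendsto (fun k => η k x) Filter.atTop (nhds 1)) ∧
    (∀ k x, bakryGamma w m (η k) (η k) x ≤ 1 / (k + 1))

/-- Non-degeneracy of the vertex measure: `inf_x m(x) > 0`. -/
def NondegMeasure (m : V → ℝ) : Prop := ∃ c : ℝ, 0 < c ∧ ∀ x, c ≤ m x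

open scoped BoundedContinuousFunction

section WeightedSums

variable {u : V → ℝ}

theorem summable_weight_mul (hu : ∀ y, 0 ≤ u y) (hs : Summable u) {f : V → ℝ} {C : ℝ}
    (hf : ∀ y, |f y| ≤ C) : Summable fun y => u y * f y :=
  Summable.of_norm_bounded (hs.mul_right C) fun y => by
    rw [Real.norm_eq_abs, abs_mul, abs_of_nonneg (hu y)]
    exact mul_le_mul_of_nonneg_left (hf y) (hu y)

/-- Cauchy–Schwarz for weighted sums of bounded functions. -/
theorem sq_tsum_weight_mul_le (hu : ∀ y, 0 ≤ u y) (hs : Summable u) {f : V → ℝ} {C : ℝ}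
    (hf : ∀ y, |f y| ≤ C) :
    (∑' y, u y * f y) ^ 2 ≤ (∑' y, u y) * ∑' y, u y * f y ^ 2 := by
  have h1 := summable_weight_mul hu hs hf
  have h2 : Summable fun y => u y * f y ^ 2 :=
    summable_weight_mul hu hs (C := C ^ 2) fun y => by
      rw [abs_pow]
      exact pow_le_pow_left₀ (abs_nonneg _) (hf y) 2
  have key : discrim (∑' y, u y) (-2 * ∑' y, u y * f y) (∑' y, u y * f y ^ 2) ≤ 0 := by
    refine discrim_le_zero fun s => ?_
    have heq : HasSum (fun y => u y * (f y - s) ^ 2)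
        ((∑' y, u y) * (s * s) + (-2 * ∑' y, u y * f y) * s + ∑' y, u y * f y ^ 2) := by
      refine (((hs.hasSum.mul_right (s * s)).add
        ((h1.hasSum.mul_left (-2)).mul_right s)).add h2.hasSum).congr_fun fun y => ?_
      ring
    exact heq.nonneg fun y => mul_nonneg (hu y) (sq_nonneg _)
  rw [discrim] at key
  linarith

end WeightedSums

section Laplacian

variable [TopologicalSpace V] {w : V → V → ℝ} {m : V → ℝ}

theorem abs_sub_apply_le (f : V →ᵇ ℝ) (x y : V) : |f y - f x| ≤ 2 * ‖f‖ := by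
  have := f.dist_le_two_norm y x
  rwa [Real.dist_eq] at this

theorem summable_weight_mul_sub (hnonneg : ∀ x y, 0 ≤ w x y)
    (hlocfin : ∀ x, Summable fun y => w x y) (f : V →ᵇ ℝ) (x : V) :
    Summable fun y => w x y * (f y - f x) :=
  summable_weight_mul (hnonneg x) (hlocfin x) (abs_sub_apply_le f x)

theorem summable_weight_mul_sub_sq (hnonneg : ∀ x y, 0 ≤ w x y)
    (hlocfin : ∀ x, Summable fun y => w x y) (f : V →ᵇ ℝ) (x : V) :
    Summable fun y => w x y * (f y - f x) ^ 2 :=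
  summable_weight_mul (hnonneg x) (hlocfin x) (C := (2 * ‖f‖) ^ 2) fun y => by
    rw [abs_pow]
    exact pow_le_pow_left₀ (abs_nonneg _) (abs_sub_apply_le f x y) 2

theorem bakryGamma_self_eq (hnonneg : ∀ x y, 0 ≤ w x y)
    (hlocfin : ∀ x, Summable fun y => w x y) (f : V →ᵇ ℝ) (x : V) :
    bakryGamma w m f f x = (1 / (2 * m x)) * ∑' y, w x y * (f y - f x) ^ 2 := by
  have h1 := summable_weight_mul_sub hnonneg hlocfin f x
  have h2 := summable_weight_mul_sub_sq hnonneg hlocfin f x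
  have h3 : ∑' y, w x y * (f y * f y - f x * f x) =
      ∑' y, w x y * (f y - f x) ^ 2 + 2 * f x * ∑' y, w x y * (f y - f x) := by
    rw [← (h2.hasSum.add (h1.hasSum.mul_left (2 * f x))).tsum_eq]
    exact tsum_congr fun y => by ring
  simp only [bakryGamma, graphLap]
  rw [h3]
  ring

theorem bakryGamma_self_nonneg (hnonneg : ∀ x y, 0 ≤ w x y) (hm : ∀ x, 0 < m x)
    (hlocfin : ∀ x, Summable fun y => w x y) (f : V →ᵇ ℝ) (x : V) :
    0 ≤ bakryGamma w m f f x := by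
  rw [bakryGamma_self_eq hnonneg hlocfin]
  have := hm x
  exact mul_nonneg (by positivity) (tsum_nonneg fun y => mul_nonneg (hnonneg x y) (sq_nonneg _))

theorem graphLap_sq_le (hnonneg : ∀ x y, 0 ≤ w x y) (hm : ∀ x, 0 < m x)
    (hlocfin : ∀ x, Summable fun y => w x y) (f : V →ᵇ ℝ) (x : V) :
    graphLap w m f x ^ 2 ≤ 2 * nDeg w m x * bakryGamma w m f f x := by
  rw [bakryGamma_self_eq hnonneg hlocfin, graphLap, nDeg, vertexDeg]
  have hmx := hm x
  have := sq_tsum_weight_mul_le (hnonneg x) (hlocfin x) (abs_sub_apply_le f x)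
  calc (1 / m x * ∑' y, w x y * (f y - f x)) ^ 2
      = (1 / m x) ^ 2 * (∑' y, w x y * (f y - f x)) ^ 2 := by ring
    _ ≤ (1 / m x) ^ 2 * ((∑' y, w x y) * ∑' y, w x y * (f y - f x) ^ 2) := by gcongr
    _ = _ := by field_simp

theorem weight_mul_sq_le_bakryGamma (hnonneg : ∀ x y, 0 ≤ w x y) (hm : ∀ x, 0 < m x)
    (hlocfin : ∀ x, Summable fun y => w x y) (f : V →ᵇ ℝ) (x y : V) :
    w x y * (f y - f x) ^ 2 ≤ 2 * m x * bakryGamma w m f f x := by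
  have hmx := hm x
  rw [bakryGamma_self_eq hnonneg hlocfin, ← mul_assoc, mul_one_div_cancel (by positivity), one_mul]
  exact (summable_weight_mul_sub_sq hnonneg hlocfin f x).le_tsum y
    fun z _ => mul_nonneg (hnonneg x z) (sq_nonneg _)

theorem bakryGamma_self_le_of_lipschitz (hnonneg : ∀ x y, 0 ≤ w x y) (hm : ∀ x, 0 < m x)
    (hlocfin : ∀ x, Summable fun y => w x y) (f : V →ᵇ ℝ)
    (hf : ∀ x y, 0 < w x y → |f y - f x| ≤ 1) (x : V) :
    bakryGamma w m f f x ≤ nDeg w m x / 2 := by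
  have hmx := hm x
  rw [bakryGamma_self_eq hnonneg hlocfin, nDeg, vertexDeg]
  have : ∑' y, w x y * (f y - f x) ^ 2 ≤ ∑' y, w x y := by
    refine (summable_weight_mul_sub_sq hnonneg hlocfin f x).tsum_le_tsum (fun y => ?_) (hlocfin x)
    rcases (hnonneg x y).eq_or_lt with h | h
    · simp [← h]
    · exact mul_le_of_le_one_right h.le ((sq_le_one_iff_abs_le_one _).2 (hf x y h))
  calc _ ≤ 1 / (2 * m x) * ∑' y, w x y := by gcongr
    _ = _ := by field_simp

/-- The graph Laplacian of a graph with bounded degree, as a bounded operator. -/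
theorem exists_lapCLM [DiscreteTopology V] (hnonneg : ∀ x y, 0 ≤ w x y) (hm : ∀ x, 0 < m x)
    (hlocfin : ∀ x, Summable fun y => w x y) {D : ℝ} (hD : ∀ x, nDeg w m x ≤ D) :
    ∃ L : (V →ᵇ ℝ) →L[ℝ] (V →ᵇ ℝ), ∀ f x, L f x = graphLap w m f x := by
  have hbound : ∀ (f : V →ᵇ ℝ) (x : V), ‖graphLap w m f x‖ ≤ (2 * |D|) * ‖f‖ := fun f x => by
    have hmx := hm x
    have h1 : |∑' y, w x y * (f y - f x)| ≤ (∑' y, w x y) * (2 * ‖f‖) := by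
      rw [← Real.norm_eq_abs]
      refine tsum_of_norm_bounded ((hlocfin x).hasSum.mul_right (2 * ‖f‖)) fun y => ?_
      rw [Real.norm_eq_abs, abs_mul, abs_of_nonneg (hnonneg x y)]
      exact mul_le_mul_of_nonneg_left (abs_sub_apply_le f x y) (hnonneg x y)
    rw [graphLap, Real.norm_eq_abs, abs_mul, abs_of_pos (by positivity)]
    calc _ ≤ 1 / m x * ((∑' y, w x y) * (2 * ‖f‖)) := by gcongr
      _ = nDeg w m x * (2 * ‖f‖) := by rw [nDeg, vertexDeg]; ring
      _ ≤ |D| * (2 * ‖f‖) := by gcongr; exact (hD x).trans (le_abs_self D)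
      _ = _ := by ring
  refine ⟨LinearMap.mkContinuous
    { toFun := fun f => BoundedContinuousFunction.ofNormedAddCommGroupDiscrete
        (graphLap w m f) _ (hbound f)
      map_add' := fun f g => ?_
      map_smul' := fun c f => ?_ } (2 * |D|) fun f => ?_, fun f x => rfl⟩
  · ext x
    change graphLap w m (f + g) x = graphLap w m f x + graphLap w m g x
    simp only [graphLap]
    rw [← mul_add, ← (summable_weight_mul_sub hnonneg hlocfin f x).tsum_add
      (summable_weight_mul_sub hnonneg hlocfin g x)]
    congr 1
    exact tsum_congr fun y => by simp only [Pi.add_apply]; ring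
  · ext x
    change graphLap w m (c • f) x = c * graphLap w m f x
    have h : ∑' y, w x y * ((c • ⇑f) y - (c • ⇑f) x) = c * ∑' y, w x y * (f y - f x) := by
      rw [← tsum_mul_left]
      exact tsum_congr fun y => by simp only [Pi.smul_apply, smul_eq_mul]; ring
    rw [graphLap, graphLap, h]
    ring
  · exact (BoundedContinuousFunction.norm_le (by positivity)).2 (hbound f)

/-- If `Deg ≤ D` then `Δ + D` preserves nonnegativity. -/
theorem graphLap_add_nonneg (hnonneg : ∀ x y, 0 ≤ w x y) (hm : ∀ x, 0 < m x)
    (hlocfin : ∀ x, Summable fun y => w x y) {D : ℝ} (hD : ∀ x, nDeg w m x ≤ D)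
    (f : V →ᵇ ℝ) (hf : ∀ x, 0 ≤ f x) (x : V) : 0 ≤ graphLap w m f x + D * f x := by
  have hmx := hm x
  have h : -(vertexDeg w x * f x) ≤ ∑' y, w x y * (f y - f x) := by
    rw [vertexDeg, ← tsum_mul_right, ← tsum_neg]
    refine ((hlocfin x).mul_right (f x)).neg.tsum_le_tsum (fun y => ?_)
      (summable_weight_mul_sub hnonneg hlocfin f x)
    nlinarith [mul_nonneg (hnonneg x y) (hf y)]
  have h2 : -(nDeg w m x * f x) ≤ graphLap w m f x :=
    calc _ = 1 / m x * -(vertexDeg w x * f x) := by rw [nDeg]; ring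
      _ ≤ _ := mul_le_mul_of_nonneg_left h (by positivity)
  nlinarith [mul_le_mul_of_nonneg_right (hD x) (hf x)]

end Laplacian

section Semigroup

/-- The uniformly continuous semigroup generated by a bounded operator. -/
theorem exists_semigroup {E : Type*} [NormedAddCommGroup E] [NormedSpace ℝ E] [CompleteSpace E]
    (A : E →L[ℝ] E) : ∃ S : ℝ → E →L[ℝ] E, (∀ v, S 0 v = v) ∧
      (∀ t, HasDerivAt S ((S t).comp A) t) ∧ (∀ t v, S t (A v) = A (S t v)) ∧
      ∀ t v, HasSum (fun k : ℕ => ((k.factorial : ℝ)⁻¹ * t ^ k) • A^[k] v) (S t v) := by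
  refine ⟨fun t => NormedSpace.exp (t • A), fun v => by simp [NormedSpace.exp_zero],
    fun t => hasDerivAt_exp_smul_const A t, fun t v => ?_, fun t v => ?_⟩
  · exact DFunLike.congr_fun (((Commute.refl A).smul_left t).exp_left).eq v
  · have h := (NormedSpace.exp_series_hasSum_exp' (𝕂 := ℝ) (t • A)).mapL
      (ContinuousLinearMap.apply ℝ E v)
    refine h.congr_fun fun k => ?_
    simp [smul_pow, mul_smul]

end Semigroup

section MaximumPrinciple

variable [TopologicalSpace V]

theorem apply_nonneg_of_hasSum {B : (V →ᵇ ℝ) →L[ℝ] (V →ᵇ ℝ)}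
    (hB : ∀ f : V →ᵇ ℝ, (∀ x, 0 ≤ f x) → ∀ x, 0 ≤ B f x)
    {t : ℝ} (ht : 0 ≤ t) {f g : V →ᵇ ℝ} (hf : ∀ x, 0 ≤ f x)
    (hg : HasSum (fun k : ℕ => ((k.factorial : ℝ)⁻¹ * t ^ k) • B^[k] f) g) (x : V) :
    0 ≤ g x := by
  have hpow : ∀ k x, 0 ≤ (B^[k] f) x := fun k => by
    induction k with
    | zero => exact hf
    | succ k ih => rw [Function.iterate_succ_apply']; exact hB _ ih
  have hs := hg.mapL (BoundedContinuousFunction.evalCLM ℝ x)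
  exact hs.nonneg fun k => mul_nonneg (by positivity) (hpow k x)

/-- The parabolic maximum principle for a bounded generator `L` with `L + D` positive. -/
theorem nonpos_of_deriv_le {L : (V →ᵇ ℝ) →L[ℝ] (V →ᵇ ℝ)} {D : ℝ}
    (hL : ∀ f : V →ᵇ ℝ, (∀ x, 0 ≤ f x) → ∀ x, 0 ≤ L f x + D * f x)
    {h h' : ℝ → (V →ᵇ ℝ)} (hh : ∀ t, HasDerivAt h (h' t) t)
    (hle : ∀ t, 0 ≤ t → ∀ x, h' t x ≤ L (h t) x) (h0 : ∀ x, h 0 x ≤ 0)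
    {T : ℝ} (hT : 0 ≤ T) (x : V) : h T x ≤ 0 := by
  set B : (V →ᵇ ℝ) →L[ℝ] (V →ᵇ ℝ) := L + D • ContinuousLinearMap.id ℝ _ with hB_def
  obtain ⟨S, hS0, hS, -, hSsum⟩ := exists_semigroup B
  have hneg : ∀ {t : ℝ}, 0 ≤ t → ∀ {f : V →ᵇ ℝ}, (∀ x, f x ≤ 0) →
      ∀ x, S t f x ≤ 0 := fun ht f hf x => by
    have := apply_nonneg_of_hasSum hL ht (f := -f) (fun y => neg_nonneg.2 (hf y)) (hSsum _ _) x
    rw [map_neg] at this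
    exact neg_nonneg.1 this
  have hderiv : ∀ s : ℝ, HasDerivAt (fun s => S (T - s) (Real.exp (D * s) • h s) x)
      (S (T - s) (Real.exp (D * s) • (h' s - L (h s))) x) s := fun s => by
    have h1 : HasDerivAt (fun s : ℝ => S (T - s)) (-((S (T - s)).comp B)) s := by
      have := (hS (T - s)).scomp s ((hasDerivAt_id s).const_sub T)
      rwa [neg_one_smul] at this
    have h2 : HasDerivAt (fun s : ℝ => Real.exp (D * s)) (Real.exp (D * s) * D) s := by
      simpa using ((hasDerivAt_id s).const_mul D).exp
    have h3 := h1.clm_apply (h2.smul (hh s))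
    have h4 := (BoundedContinuousFunction.evalCLM ℝ x).hasFDerivAt.comp_hasDerivAt s h3
    refine h4.congr_deriv ?_
    change (-(S (T - s) (B (Real.exp (D * s) • h s))) +
      S (T - s) (Real.exp (D * s) • h' s + (Real.exp (D * s) * D) • h s)) x = _
    congr 1
    rw [← map_neg, ← map_add]
    congr 1
    simp only [hB_def, add_apply, smul_apply,
      ContinuousLinearMap.id_apply, map_smul]
    module
  have hanti := antitoneOn_of_hasDerivWithinAt_nonpos (convex_Icc 0 T)
    (fun s _ => (hderiv s).continuousAt.continuousWithinAt)
    (fun s _ => (hderiv s).hasDerivWithinAt) (fun s hs => by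
      rw [interior_Icc] at hs
      refine hneg (sub_nonneg.2 hs.2.le) (fun y => ?_) x
      exact mul_nonpos_of_nonneg_of_nonpos (Real.exp_nonneg _)
        (sub_nonpos.2 (hle s hs.1.le y)))
  have hfin := hanti (Set.left_mem_Icc.2 hT) (Set.right_mem_Icc.2 hT) hT
  have hstart : S (T - 0) (Real.exp (D * 0) • h 0) x ≤ 0 :=
    hneg (by simpa using hT) (fun y => by simpa using h0 y) x
  have hend : Real.exp (D * T) * h T x ≤ 0 := by
    have := hfin.trans hstart
    simpa [hS0] using this
  exact nonpos_of_mul_nonpos_right hend (Real.exp_pos _)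

end MaximumPrinciple

section GradientEstimate

variable [TopologicalSpace V] {w : V → V → ℝ} {m : V → ℝ}
  {L : (V →ᵇ ℝ) →L[ℝ] (V →ᵇ ℝ)}

/-- The carré du champ of a bounded generator, as a bounded function. -/
noncomputable def gammaBCF (L : (V →ᵇ ℝ) →L[ℝ] (V →ᵇ ℝ)) (f g : V →ᵇ ℝ) : V →ᵇ ℝ :=
  (1 / 2 : ℝ) • (L (f * g) - f * L g - g * L f)

theorem gammaBCF_apply (hL : ∀ f x, L f x = graphLap w m f x) (f g : V →ᵇ ℝ) (x : V) :
    gammaBCF L f g x = bakryGamma w m f g x := by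
  change (1 / 2 : ℝ) * (L (f * g) x - f x * L g x - g x * L f x) = _
  rw [hL, hL, hL, bakryGamma]
  change (1 / 2 : ℝ) * (graphLap w m (fun z => f z * g z) x - _ - _) = _
  ring

theorem coe_gammaBCF (hL : ∀ f x, L f x = graphLap w m f x) (f g : V →ᵇ ℝ) :
    ⇑(gammaBCF L f g) = bakryGamma w m f g :=
  funext (gammaBCF_apply hL f g)

theorem coe_lapCLM (hL : ∀ f x, L f x = graphLap w m f x) (f : V →ᵇ ℝ) :
    ⇑(L f) = graphLap w m f :=
  funext (hL f)

theorem bakryGamma2_self_eq (hL : ∀ f x, L f x = graphLap w m f x) (f : V →ᵇ ℝ) (x : V) :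
    bakryGamma2 w m f f x = L (gammaBCF L f f) x / 2 - gammaBCF L f (L f) x := by
  rw [bakryGamma2, hL, coe_gammaBCF hL, ← coe_lapCLM hL f, ← gammaBCF_apply hL]
  ring

/-- The semigroup gradient estimate: `CD(K,n)` implies
`e^{2Kt} Γ(P_t f) + (e^{2Kt} - 1)/(Kn) (Δ P_t f)² ≤ ‖Γf‖_∞`. -/
theorem gradient_estimate (hnonneg : ∀ x y, 0 ≤ w x y) (hm : ∀ x, 0 < m x)
    (hlocfin : ∀ x, Summable fun y => w x y) {D : ℝ} (hD : ∀ x, nDeg w m x ≤ D)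
    (hL : ∀ f x, L f x = graphLap w m f x) {K n : ℝ} (hK : 0 < K) (hn : 0 < n)
    (hCD : CDCond w m K n) {g : ℝ → (V →ᵇ ℝ)} (hg : ∀ t, HasDerivAt g (L (g t)) t)
    {C : ℝ} (hC : ∀ x, bakryGamma w m (g 0) (g 0) x ≤ C) {t : ℝ} (ht : 0 ≤ t) (x : V) :
    Real.exp (2 * K * t) * bakryGamma w m (g t) (g t) x +
      (Real.exp (2 * K * t) - 1) / (K * n) * graphLap w m (g t) x ^ 2 ≤ C := by
  have hLg : ∀ t, HasDerivAt (fun t => L (g t)) (L (L (g t))) t := fun t =>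
    L.hasFDerivAt.comp_hasDerivAt t (hg t)
  have hexp : ∀ t : ℝ, HasDerivAt (fun t => Real.exp (2 * K * t))
      (Real.exp (2 * K * t) * (2 * K)) t := fun t => by
    simpa using ((hasDerivAt_id t).const_mul (2 * K)).exp
  have hgam : ∀ t, HasDerivAt (fun t => gammaBCF L (g t) (g t))
      ((2 : ℝ) • gammaBCF L (g t) (L (g t))) t := fun t => by
    have h1 := L.hasFDerivAt.comp_hasDerivAt t ((hg t).mul (hg t))
    have h2 := (((h1.sub ((hg t).mul (hLg t))).sub ((hg t).mul (hLg t))).const_smul (1 / 2 : ℝ))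
    refine h2.congr_deriv ?_
    change (1 / 2 : ℝ) • (L (L (g t) * g t + g t * L (g t)) -
        (L (g t) * L (g t) + g t * L (L (g t))) - (L (g t) * L (g t) + g t * L (L (g t)))) =
      (2 : ℝ) • (1 / 2 : ℝ) • (L (g t * L (g t)) - g t * L (L (g t)) - L (g t) * L (g t))
    rw [mul_comm (L (g t)) (g t), map_add]
    module
  have hh : ∀ t, HasDerivAt (fun t => Real.exp (2 * K * t) • gammaBCF L (g t) (g t) +
      ((Real.exp (2 * K * t) - 1) / (K * n)) • (L (g t) * L (g t)) -
        BoundedContinuousFunction.const V C) _ t := fun t =>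
    (((hexp t).smul (hgam t)).add
      ((((hexp t).sub_const 1).div_const (K * n)).smul ((hLg t).mul (hLg t)))).sub_const _
  have hconst : ∀ x, L (BoundedContinuousFunction.const V C) x = 0 := fun x => by
    rw [hL, graphLap]; simp
  have hmain := nonpos_of_deriv_le (L := L) (D := D) (fun f hf x => by
      rw [hL]; exact graphLap_add_nonneg hnonneg hm hlocfin hD f hf x) hh
    (fun s hs y => ?_) (fun y => ?_) ht x
  · change Real.exp (2 * K * t) * gammaBCF L (g t) (g t) x +
      (Real.exp (2 * K * t) - 1) / (K * n) * (L (g t) x * L (g t) x) - C ≤ 0 at hmain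
    rw [gammaBCF_apply hL, hL] at hmain
    linarith [sq (graphLap w m (g t) x)]
  · have hcd := hCD (g s) y
    rw [bakryGamma2_self_eq hL, ← hL, ← gammaBCF_apply hL] at hcd
    have hnn := bakryGamma_self_nonneg hnonneg hm hlocfin (L (g s)) y
    rw [← gammaBCF_apply hL] at hnn
    have hsq : L (L (g s) * L (g s)) y =
        2 * gammaBCF L (L (g s)) (L (g s)) y + 2 * (L (g s) y * L (L (g s)) y) := by
      change _ = 2 * ((1 / 2 : ℝ) * (L (L (g s) * L (g s)) y - L (g s) y * L (L (g s)) y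
        - L (g s) y * L (L (g s)) y)) + _
      ring
    have hLh : L (Real.exp (2 * K * s) • gammaBCF L (g s) (g s) +
        ((Real.exp (2 * K * s) - 1) / (K * n)) • (L (g s) * L (g s)) -
          BoundedContinuousFunction.const V C) y =
        Real.exp (2 * K * s) * L (gammaBCF L (g s) (g s)) y +
        (Real.exp (2 * K * s) - 1) / (K * n) * L (L (g s) * L (g s)) y -
          L (BoundedContinuousFunction.const V C) y := by
      rw [map_sub, map_add, map_smul, map_smul]
      rfl
    refine le_of_le_of_eq ?_ hLh.symm
    change Real.exp (2 * K * s) * (2 * gammaBCF L (g s) (L (g s)) y) +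
        (Real.exp (2 * K * s) * (2 * K)) * gammaBCF L (g s) (g s) y +
        ((Real.exp (2 * K * s) - 1) / (K * n) *
          (L (L (g s)) y * L (g s) y + L (g s) y * L (L (g s)) y) +
        Real.exp (2 * K * s) * (2 * K) / (K * n) * (L (g s) y * L (g s) y)) ≤
      Real.exp (2 * K * s) * L (gammaBCF L (g s) (g s)) y +
        (Real.exp (2 * K * s) - 1) / (K * n) * L (L (g s) * L (g s)) y -
          L (BoundedContinuousFunction.const V C) y
    rw [hconst, hsq]
    have hE : 1 ≤ Real.exp (2 * K * s) := Real.one_le_exp (by positivity)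
    have hc : 0 ≤ (Real.exp (2 * K * s) - 1) / (K * n) :=
      div_nonneg (sub_nonneg.2 hE) (by positivity)
    have h1 := mul_le_mul_of_nonneg_left hcd (by positivity : 0 ≤ 2 * Real.exp (2 * K * s))
    have h2 := mul_nonneg hc hnn
    have h3 : Real.exp (2 * K * s) * (2 * K) / (K * n) = 2 * Real.exp (2 * K * s) * (1 / n) := by
      field_simp
    rw [h3]
    nlinarith [h1, h2]
  · change Real.exp (2 * K * 0) * gammaBCF L (g 0) (g 0) y +
      (Real.exp (2 * K * 0) - 1) / (K * n) * (L (g 0) y * L (g 0) y) - C ≤ 0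
    rw [gammaBCF_apply hL]
    simpa using hC y

end GradientEstimate

section Oscillation

/-- The derivative of `t ↦ -√(nD/(2K)) arcsin(c e^{-Kt})` dominates every `a` allowed by the
gradient estimate, where `c = 1/√(Kn/(2D) + 1)`. -/
theorem hasDerivAt_arcsin_bound {K n D : ℝ} (hK : 0 < K) (hn : 0 < n) (hD : 0 < D) {t : ℝ}
    (ht : 0 ≤ t) :
    ∃ b, HasDerivAt (fun t => -(Real.sqrt (n * D / (2 * K)) *
        Real.arcsin (1 / Real.sqrt (K * n / (2 * D) + 1) * Real.exp (-K * t)))) b t ∧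
      ∀ a G : ℝ, a ^ 2 ≤ 2 * D * G →
        Real.exp (2 * K * t) * G + (Real.exp (2 * K * t) - 1) / (K * n) * a ^ 2 ≤ D / 2 →
        |a| ≤ b := by
  have hderiv : HasDerivAt (fun t => Real.exp (-K * t)) (Real.exp (-K * t) * -K) t := by
    simpa using ((hasDerivAt_id t).const_mul (-K)).exp
  set c := 1 / Real.sqrt (K * n / (2 * D) + 1) with hc
  set e := Real.exp (-K * t) with he
  have hc0 : 0 < c := by positivity
  have hcsq : c ^ 2 = 2 * D / (K * n + 2 * D) := by
    rw [hc, div_pow, Real.sq_sqrt (by positivity)]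
    field_simp
  have he0 : 0 < e := Real.exp_pos _
  have he1 : e ≤ 1 := Real.exp_le_one_iff.2 (by nlinarith [mul_nonneg hK.le ht])
  have hE : Real.exp (2 * K * t) = 1 / e ^ 2 := by
    rw [he, ← Real.exp_nat_mul, one_div, ← Real.exp_neg]
    congr 1
    push_cast
    ring
  have hKn : 0 < K * n := by positivity
  have hlt : (c * e) ^ 2 < 1 := by
    have h1 : c ^ 2 < 1 := by rw [hcsq, div_lt_one (by positivity)]; linarith
    have h2 : e ^ 2 ≤ 1 := pow_le_one₀ he0.le he1
    nlinarith [mul_pow c e 2, sq_nonneg c]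
  have hce : c * e < 1 := by nlinarith [mul_pos hc0 he0]
  refine ⟨Real.sqrt (n * D / (2 * K)) * (1 / Real.sqrt (1 - (c * e) ^ 2) * (c * (e * K))), ?_, ?_⟩
  · have h := (((Real.hasDerivAt_arcsin (x := c * e) (by nlinarith [mul_pos hc0 he0])
      hce.ne).comp t (hderiv.const_mul c)).const_mul (Real.sqrt (n * D / (2 * K)))).neg
    exact h.congr_deriv (by ring)
  · intro a G h1 h2
    have hs : 0 < 1 - (c * e) ^ 2 := by linarith
    refine abs_le_of_sq_le_sq ?_ (by positivity)
    rw [mul_pow, mul_pow, Real.sq_sqrt (by positivity), div_pow, Real.sq_sqrt hs.le]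
    rw [hE] at h2
    have h3 : (K * n + 2 * D * (1 - e ^ 2)) * a ^ 2 ≤ D ^ 2 * (K * n) * e ^ 2 := by
      have h4 : G + (1 - e ^ 2) / (K * n) * a ^ 2 ≤ D / 2 * e ^ 2 := by
        have := mul_le_mul_of_nonneg_right h2 (sq_nonneg e)
        calc _ = (1 / e ^ 2 * G + (1 / e ^ 2 - 1) / (K * n) * a ^ 2) * e ^ 2 := by field_simp
          _ ≤ _ := this
      have h5 : a ^ 2 + 2 * D * ((1 - e ^ 2) / (K * n) * a ^ 2) ≤ D ^ 2 * e ^ 2 := by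
        nlinarith
      calc _ = (a ^ 2 + 2 * D * ((1 - e ^ 2) / (K * n) * a ^ 2)) * (K * n) := by field_simp
        _ ≤ D ^ 2 * e ^ 2 * (K * n) := mul_le_mul_of_nonneg_right h5 hKn.le
        _ = _ := by ring
    have hden : 0 < K * n + 2 * D * (1 - e ^ 2) := by
      nlinarith [pow_le_one₀ he0.le he1 (n := 2)]
    have hval : n * D / (2 * K) * (1 ^ 2 / (1 - (c * e) ^ 2) * (c * (e * K)) ^ 2) =
        D ^ 2 * (K * n) * e ^ 2 / (K * n + 2 * D * (1 - e ^ 2)) := by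
      have h6 : 1 - (c * e) ^ 2 = (K * n + 2 * D * (1 - e ^ 2)) / (K * n + 2 * D) := by
        rw [mul_pow, hcsq]; field_simp; ring
      rw [h6, mul_pow c, hcsq]
      field_simp
    rw [hval, le_div_iff₀ hden]
    linarith

end Oscillation

section CombDist

variable {w : V → V → ℝ}

theorem combDist_le_add_one (hconn : GraphConnected w) (x : V) {y z : V} (h : 0 < w y z) :
    combDist w x z ≤ combDist w x y + 1 := by
  obtain ⟨p, hp0, hpk, hp⟩ : ∃ p, IsWalk w x y (combDist w x y) p := Nat.sInf_mem (hconn x y)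
  refine Nat.sInf_le ⟨fun i => if i ≤ combDist w x y then p i else z, by simp [hp0], by simp,
    fun i hi => ?_⟩
  rcases (Nat.lt_succ_iff.1 hi).lt_or_eq with hlt | rfl
  · simpa [hlt.le, Nat.succ_le_of_lt hlt] using hp i hlt
  · simpa [hpk] using h

theorem combDist_self (x : V) : combDist w x x = 0 :=
  Nat.sInf_eq_zero.2 (Or.inl ⟨fun _ => x, rfl, rfl, fun _ h => absurd h (Nat.not_lt_zero _)⟩)

/-- If the oscillation across every edge vanishes in the limit, so does every oscillation. -/
theorem tendsto_sub_of_connected (hconn : GraphConnected w) {g : ℝ → V → ℝ}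
    (hg : ∀ x y, 0 < w x y → Tendsto (fun t => g t y - g t x) atTop (nhds 0)) (x y : V) :
    Tendsto (fun t => g t y - g t x) atTop (nhds 0) := by
  obtain ⟨k, p, rfl, rfl, hp⟩ := hconn x y
  have key : ∀ i ≤ k, Tendsto (fun t => g t (p i) - g t (p 0)) atTop (nhds 0) := fun i => by
    induction i with
    | zero => simp
    | succ i ih =>
      intro hi
      simpa using (hg _ _ (hp i hi)).add (ih (Nat.le_of_succ_le hi))
  exact key k le_rfl

end CombDist

/-- Under `CD(K,n)`, a bounded function with `Γf ≤ D/2` has oscillation at most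
`√(2nD/K) arcsin(1/√(Kn/(2D) + 1))`. -/
theorem sub_le_of_bakryGamma_le [TopologicalSpace V] [DiscreteTopology V]
    {w : V → V → ℝ} {m : V → ℝ} (hnonneg : ∀ x y, 0 ≤ w x y) (hm : ∀ x, 0 < m x)
    (hlocfin : ∀ x, Summable fun y => w x y) (hconn : GraphConnected w)
    {D : ℝ} (hD0 : 0 < D) (hD : ∀ x, nDeg w m x ≤ D)
    {K n : ℝ} (hK : 0 < K) (hn : 0 < n) (hCD : CDCond w m K n) (f : V →ᵇ ℝ)
    (hf : ∀ x, bakryGamma w m f f x ≤ D / 2) (x₀ y₀ : V) :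
    f y₀ - f x₀ ≤ Real.sqrt (2 * n * D / K) *
      Real.arcsin (1 / Real.sqrt (K * n / (2 * D) + 1)) := by
  obtain ⟨L, hL⟩ := exists_lapCLM hnonneg hm hlocfin hD
  obtain ⟨S, hS0, hS, hScomm, -⟩ := exists_semigroup L
  set g : ℝ → (V →ᵇ ℝ) := fun t => S t f
  have hg : ∀ t, HasDerivAt g (L (g t)) t := fun t => by
    have := (hS t).clm_apply (hasDerivAt_const t f)
    rw [map_zero, add_zero] at this
    exact this.congr_deriv (hScomm t f)
  have hg0 : g 0 = f := hS0 f
  have hest : ∀ t, 0 ≤ t → ∀ x, Real.exp (2 * K * t) * bakryGamma w m (g t) (g t) x +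
      (Real.exp (2 * K * t) - 1) / (K * n) * graphLap w m (g t) x ^ 2 ≤ D / 2 := fun t ht x =>
    gradient_estimate hnonneg hm hlocfin hD hL hK hn hCD hg (by rwa [hg0]) ht x
  have hgx : ∀ x t, HasDerivAt (fun t => g t x) (graphLap w m (g t) x) t := fun x t => by
    rw [← hL]
    exact (BoundedContinuousFunction.evalCLM ℝ x).hasFDerivAt.comp_hasDerivAt t (hg t)
  set A := Real.sqrt (n * D / (2 * K))
  set c := 1 / Real.sqrt (K * n / (2 * D) + 1) with hc
  set β : ℝ → ℝ := fun t => -(A * Real.arcsin (c * Real.exp (-K * t))) with hβ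
  choose! b hb hab using fun t (ht : 0 ≤ t) => hasDerivAt_arcsin_bound hK hn hD0 ht
  have hlap : ∀ t, 0 ≤ t → ∀ x, |graphLap w m (g t) x| ≤ b t := fun t ht x => by
    refine hab t ht _ _ ?_ (hest t ht x)
    refine (graphLap_sq_le hnonneg hm hlocfin (g t) x).trans ?_
    gcongr
    · exact bakryGamma_self_nonneg hnonneg hm hlocfin _ x
    · exact hD x
  have hβ0 : ∀ t, β t ≤ 0 := fun t => neg_nonpos.2 <|
    mul_nonneg (Real.sqrt_nonneg _) (Real.arcsin_nonneg.2 (by positivity))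
  have hmove : ∀ s : ℝ, |s| ≤ 1 → ∀ x T, 0 ≤ T → s * f x ≤ s * g T x - β 0 := by
    intro s hs x T hT
    have hmono := monotoneOn_of_hasDerivWithinAt_nonneg (convex_Icc 0 T)
      (f := fun t => s * g t x + β t) (f' := fun t => s * graphLap w m (g t) x + b t)
      (fun t ht => (((hgx x t).const_mul s).add
        (hb t ht.1)).continuousAt.continuousWithinAt)
      (fun t ht => (((hgx x t).const_mul s).add
        (hb t (interior_subset ht).1)).hasDerivWithinAt) (fun t ht => by
        have h1 := hlap t (interior_subset ht).1 x
        have h2 : |s * graphLap w m (g t) x| ≤ b t := by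
          rw [abs_mul]
          exact (mul_le_of_le_one_left (abs_nonneg _) hs).trans h1
        linarith [neg_abs_le (s * graphLap w m (g t) x)])
    have h := hmono (Set.left_mem_Icc.2 hT) (Set.right_mem_Icc.2 hT) hT
    simp only [hg0] at h
    linarith [hβ0 T]
  have hosc : ∀ x y, 0 < w x y → Tendsto (fun t => g t y - g t x) atTop (nhds 0) := by
    intro x y hxy
    have hmx := hm x
    have hup : Tendsto (fun t => m x * D / w x y * Real.exp (-(2 * K * t))) atTop (nhds 0) := by
      have h1 : Tendsto (fun t : ℝ => 2 * K * t) atTop atTop :=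
        tendsto_id.const_mul_atTop (by positivity)
      simpa using (Real.tendsto_exp_neg_atTop_nhds_zero.comp h1).const_mul (m x * D / w x y)
    have hsq : Tendsto (fun t => (g t y - g t x) ^ 2) atTop (nhds 0) := by
      refine squeeze_zero' (Eventually.of_forall fun t => sq_nonneg _) ?_ hup
      filter_upwards [eventually_ge_atTop 0] with t ht
      have h1 := weight_mul_sq_le_bakryGamma hnonneg hm hlocfin (g t) x y
      have hE : 1 ≤ Real.exp (2 * K * t) := Real.one_le_exp (by positivity)
      have h2 : Real.exp (2 * K * t) * bakryGamma w m (g t) (g t) x ≤ D / 2 := by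
        have h3 : 0 ≤ (Real.exp (2 * K * t) - 1) / (K * n) * graphLap w m (g t) x ^ 2 :=
          mul_nonneg (div_nonneg (sub_nonneg.2 hE) (by positivity)) (sq_nonneg _)
        linarith [hest t ht x]
      rw [Real.exp_neg, ← div_eq_mul_inv, div_div, le_div_iff₀ (by positivity)]
      calc (g t y - g t x) ^ 2 * (w x y * Real.exp (2 * K * t))
          = w x y * (g t y - g t x) ^ 2 * Real.exp (2 * K * t) := by ring
        _ ≤ 2 * m x * bakryGamma w m (g t) (g t) x * Real.exp (2 * K * t) := by gcongr
        _ = 2 * m x * (Real.exp (2 * K * t) * bakryGamma w m (g t) (g t) x) := by ring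
        _ ≤ 2 * m x * (D / 2) := by gcongr
        _ = m x * D := by ring
    have := hsq.sqrt
    simp only [Real.sqrt_sq_eq_abs, Real.sqrt_zero] at this
    exact (tendsto_zero_iff_abs_tendsto_zero _).2 this
  have hlim := (tendsto_sub_of_connected hconn (g := fun t => ⇑(g t)) hosc x₀ y₀).add_const
    (-(2 * β 0))
  rw [zero_add] at hlim
  have hle : f y₀ - f x₀ ≤ -(2 * β 0) := by
    refine ge_of_tendsto hlim ?_
    filter_upwards [eventually_ge_atTop 0] with t ht
    have h1 := hmove 1 (by simp) y₀ t ht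
    have h2 := hmove (-1) (by simp) x₀ t ht
    linarith
  have hA2 : Real.sqrt (2 * n * D / K) = 2 * A := by
    rw [show 2 * n * D / K = 2 ^ 2 * (n * D / (2 * K)) by field_simp,
      Real.sqrt_mul (by positivity), Real.sqrt_sq (by norm_num)]
  rw [hA2]
  refine hle.trans_eq ?_
  simp only [hβ, mul_zero, Real.exp_zero, mul_one]
  ring

/-- The combinatorial diameter `diam_d(G) = sup_{x,y} d(x,y)` is bounded, i.e. every
combinatorial distance is bounded, by the stated quantity. -/
theorem combDiam_le_of_CD [Countable V]
    (w : V → V → ℝ) (m : V → ℝ)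
    (hsymm : ∀ x y, w x y = w y x) (hnonneg : ∀ x y, 0 ≤ w x y)
    (hdiag : ∀ x, w x x = 0) (hm : ∀ x, 0 < m x)
    (hlocfin : ∀ x, Summable fun y => w x y)
    (hconn : GraphConnected w)
    (hcomplete : GraphComplete w m)
    (hnondeg : NondegMeasure m)
    (hDegmax : BddAbove (Set.range fun x : V => nDeg w m x))
    (K n : ℝ) (hK : 0 < K) (hn : 0 < n) (hCD : CDCond w m K n)
    (x₀ y₀ : V) :
    (combDist w x₀ y₀ : ℝ) ≤
      Real.sqrt (2 * n * nDegMax w m / K) *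
        Real.arcsin (1 / Real.sqrt (K * n / (2 * nDegMax w m) + 1)) := by
  have hD : ∀ x, nDeg w m x ≤ nDegMax w m := fun x => le_csSup hDegmax ⟨x, rfl⟩
  have hdeg0 : ∀ x, 0 ≤ vertexDeg w x := fun x => tsum_nonneg (hnonneg x)
  rcases (div_nonneg (hdeg0 x₀) (hm x₀).le |>.trans (hD x₀)).eq_or_lt with h0 | hpos
  · have hw : ∀ x y, w x y = 0 := fun x y => by
      have h1 : vertexDeg w x ≤ 0 := by
        have := hD x
        rw [← h0, nDeg, div_le_iff₀ (hm x), zero_mul] at this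
        exact this
      exact le_antisymm (((hlocfin x).le_tsum y fun z _ => hnonneg x z).trans h1) (hnonneg x y)
    have hxy : x₀ = y₀ := by
      obtain ⟨k, p, rfl, rfl, hp⟩ := hconn x₀ y₀
      rcases k with _ | k
      · rfl
      · exact absurd (hw _ _) (hp 0 k.succ_pos).ne'
    simp [← h0, hxy, combDist_self]
  · let _ : TopologicalSpace V := ⊥
    have : DiscreteTopology V := ⟨rfl⟩
    let f : V →ᵇ ℝ := BoundedContinuousFunction.ofNormedAddCommGroupDiscrete
      (fun z => min (combDist w x₀ z : ℝ) (combDist w x₀ y₀)) (combDist w x₀ y₀) fun z => by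
        rw [Real.norm_eq_abs, abs_of_nonneg (by positivity)]
        exact min_le_right _ _
    have hf_apply : ∀ z, f z = min (combDist w x₀ z : ℝ) (combDist w x₀ y₀) := fun _ => rfl
    have hlip : ∀ x y, 0 < w x y → |f y - f x| ≤ 1 := fun x y hxy => by
      rw [hf_apply, hf_apply]
      refine (abs_min_sub_min_le_max _ _ _ _).trans ?_
      have h1 : (combDist w x₀ y : ℝ) ≤ combDist w x₀ x + 1 := by
        exact_mod_cast combDist_le_add_one hconn x₀ hxy
      have h2 : (combDist w x₀ x : ℝ) ≤ combDist w x₀ y + 1 := by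
        exact_mod_cast combDist_le_add_one hconn x₀ (hsymm x y ▸ hxy)
      rw [sub_self, abs_zero]
      exact max_le (abs_le.2 ⟨by linarith, by linarith⟩) zero_le_one
    have hgam : ∀ x, bakryGamma w m f f x ≤ nDegMax w m / 2 := fun x =>
      (bakryGamma_self_le_of_lipschitz hnonneg hm hlocfin f hlip x).trans (by linarith [hD x])
    have hmain := sub_le_of_bakryGamma_le hnonneg hm hlocfin hconn hpos hD hK hn hCD f hgam x₀ y₀
    rw [hf_apply, hf_apply, combDist_self] at hmain
    simpa using hmain
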